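/- arXiv:2312.16786 — 4 statements merged into one kernel-verified Lean document; each statement's English description precedes it below -/
import Mathlib

section
/- Let n ≥ 1, let I ⊆ [n-1] be nonempty, and set J = {n−i : i ∈ I}. Then d(I;n) = d(J;n), i.e., the number of parking functions of length n with descent set exactly I equals the number of parking functions of length n with descent set exactly J. -/
open scoped Classical

/-- `f : Fin n → Fin n` (entries 0-indexed, value `v` encodes preference `v+1`) is a
parking function: some rearrangement `f ∘ σ` is nondecreasing and its `i`-th entry
(0-indexed) is at most `i`. -/
def IsPF {n : ℕ} (f : Fin n → Fin n) : Prop :=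
  ∃ σ : Equiv.Perm (Fin n), Monotone (f ∘ σ) ∧ ∀ i : Fin n, (f (σ i) : ℕ) ≤ (i : ℕ)

/-- The (1-indexed) descent set of a tuple `a_1, …, a_k`: the indices `i ∈ [k-1]`
with `a_i > a_{i+1}`.  (Here `a_i = f ⟨i-1, _⟩`.) -/
def desSet {k : ℕ} {α : Type*} [LT α] (f : Fin k → α) : Set ℕ :=
  {i | ∃ h : 1 ≤ i ∧ i < k, f ⟨i, h.2⟩ < f ⟨i - 1, (Nat.sub_le i 1).trans_lt h.2⟩}

theorem IsPF.comp_perm {n : ℕ} {f : Fin n → Fin n} (hf : IsPF f) (π : Equiv.Perm (Fin n)) :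
    IsPF (f ∘ π) := by
  obtain ⟨σ, hm, hle⟩ := hf
  refine ⟨σ.trans π.symm, ?_, ?_⟩
  · simpa [Function.comp_def] using hm
  · simpa using hle

theorem desSet_subset_iff {k : ℕ} {α : Type*} [LinearOrder α] (f : Fin k → α) (S : Set ℕ) :
    desSet f ⊆ S ↔ ∀ (i : ℕ) (h : i + 1 < k), i + 1 ∉ S → f ⟨i, by omega⟩ ≤ f ⟨i + 1, h⟩ := by
  constructor
  · intro H i h hi
    by_contra hlt
    exact hi (H ⟨⟨by omega, h⟩, not_le.mp hlt⟩)
  · rintro H i ⟨⟨h1, h2⟩, hlt⟩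
    by_contra hi
    obtain ⟨j, rfl⟩ : ∃ j, i = j + 1 := ⟨i - 1, by omega⟩
    exact absurd (H j h2 hi) (not_le.mpr hlt)

/-- Every position `p < n` lies in a unique maximal block `[a, b)` delimited by the cut set `S`. -/
theorem exists_block (n : ℕ) (S : Finset ℕ) (p : Fin n) :
    ∃ a b : ℕ, a ≤ p ∧ (p : ℕ) < b ∧ b ≤ n ∧ (a = 0 ∨ a ∈ S) ∧ (b = n ∨ b ∈ S) ∧
      ∀ s ∈ S, ¬ (a < s ∧ s < b) := by
  have hex : ∃ b, (p : ℕ) < b ∧ (b = n ∨ b ∈ S) := ⟨n, p.2, Or.inl rfl⟩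
  refine ⟨Nat.findGreatest (fun s => s = 0 ∨ s ∈ S) p, Nat.find hex, Nat.findGreatest_le _,
    (Nat.find_spec hex).1, Nat.find_min' hex ⟨p.2, Or.inl rfl⟩,
    Nat.findGreatest_spec (P := fun s => s = 0 ∨ s ∈ S) (Nat.zero_le _) (Or.inl rfl),
    (Nat.find_spec hex).2, ?_⟩
  rintro s hs ⟨h1, h2⟩
  rcases le_or_gt s p with h | h
  · exact absurd (Nat.le_findGreatest (P := fun s => s = 0 ∨ s ∈ S) h (Or.inr hs)) (by omega)
  · exact Nat.find_min hex h2 ⟨h, Or.inr hs⟩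

/-- The permutation reversing the order of the blocks cut out by `S`, keeping the order inside each
block, turns words with descents in the mirror image of `S` into words with descents in `S`. -/
theorem exists_blockReversal (n : ℕ) (S : Finset ℕ) :
    ∃ π : Equiv.Perm (Fin n), ∀ f : Fin n → Fin n,
      desSet f ⊆ ↑(S.image (fun i => n - i)) → desSet (f ∘ π) ⊆ ↑S := by
  choose a b hap hpb hbn ha hb hab using exists_block n S
  have same : ∀ p q : Fin n, p ≤ q → (a p = a q ∧ b p = b q) ∨ b p ≤ a q := by
    intro p q hpq
    have hpq' : (p : ℕ) ≤ q := hpq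
    have h1 := hap p
    have h2 := hpb p
    have h3 := hap q
    have h4 := hpb q
    have h5 := hbn p
    have h6 := hbn q
    by_contra hcon
    have hlt : a q < b p := by omega
    have e1 : a p = a q := by
      rcases lt_trichotomy (a p) (a q) with h | h | h
      · rcases ha q with h0 | h0
        · omega
        · exact absurd ⟨h, hlt⟩ (hab p _ h0)
      · exact h
      · rcases ha p with h0 | h0
        · omega
        · exact absurd ⟨h, by omega⟩ (hab q _ h0)
    have e2 : b p = b q := by
      rcases lt_trichotomy (b p) (b q) with h | h | h
      · rcases hb p with h0 | h0
        · omega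
        · exact absurd ⟨hlt, h⟩ (hab q _ h0)
      · exact h
      · rcases hb q with h0 | h0
        · omega
        · exact absurd ⟨by omega, h⟩ (hab p _ h0)
    exact hcon (Or.inl ⟨e1, e2⟩)
  let g : Fin n → Fin n := fun p =>
    ⟨n - b p + (p - a p), by have := hap p; have := hpb p; have := hbn p; omega⟩
  have g_ne : ∀ p q : Fin n, p < q → g p ≠ g q := by
    intro p q hpq h
    have hpq' : (p : ℕ) < q := hpq
    have h' : n - b p + (p - a p) = n - b q + (q - a q) := congrArg Fin.val h
    have h1 := hap p
    have h2 := hpb p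
    have h3 := hap q
    have h4 := hpb q
    have h5 := hbn p
    have h6 := hbn q
    have := same p q hpq.le
    omega
  have g_inj : Function.Injective g := by
    intro p q h
    rcases lt_trichotomy p q with hl | hl | hl
    · exact absurd h (g_ne p q hl)
    · exact hl
    · exact absurd h.symm (g_ne q p hl)
  refine ⟨Equiv.ofBijective g (Finite.injective_iff_bijective.mp g_inj), fun f hf => ?_⟩
  rw [desSet_subset_iff] at hf ⊢
  intro i hi hiS
  have hiS' : i + 1 ∉ S := by simpa using hiS
  set p : Fin n := ⟨i, by omega⟩ with hp
  set q : Fin n := ⟨i + 1, hi⟩ with hq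
  have hpv : (p : ℕ) = i := rfl
  have hqv : (q : ℕ) = i + 1 := rfl
  have h1 := hap p
  have h2 := hpb p
  have h3 := hap q
  have h4 := hpb q
  have h5 := hbn p
  have h6 := hbn q
  have haq : a q ≠ i + 1 := by
    intro h
    rcases ha q with h0 | h0
    · omega
    · exact hiS' (h ▸ h0)
  have hs : a p = a q ∧ b p = b q := by
    rcases same p q (Fin.mk_le_mk.mpr (Nat.le_succ i)) with h | h
    · exact h
    · omega
  have hgp : (g p : ℕ) = n - b p + (p - a p) := rfl
  have hgq : (g q : ℕ) = n - b q + (q - a q) := rfl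
  have hsucc : (g q : ℕ) = g p + 1 := by omega
  have hlt : (g p : ℕ) + 1 < n := hsucc ▸ (g q).2
  have key := hf (g p) hlt (by
    intro hmem
    simp only [Finset.coe_image, Set.mem_image, Finset.mem_coe] at hmem
    obtain ⟨s, hsS, hs'⟩ := hmem
    exact hab q s hsS (by omega))
  have e : (⟨(g p : ℕ) + 1, hlt⟩ : Fin n) = g q := Fin.ext hsucc.symm
  rw [e] at key
  exact key

theorem card_desSet_subset_mirror_le (n : ℕ) (S : Finset ℕ) :
    (Finset.univ.filter (fun f : Fin n → Fin n =>
        IsPF f ∧ desSet f ⊆ ↑(S.image (fun i => n - i)))).card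
      ≤ (Finset.univ.filter (fun f : Fin n → Fin n => IsPF f ∧ desSet f ⊆ ↑S)).card := by
  obtain ⟨π, hπ⟩ := exists_blockReversal n S
  refine Finset.card_le_card_of_injOn (fun f => f ∘ π) ?_ ?_
  · intro f hf
    simp only [Finset.coe_filter, Finset.mem_univ, true_and, Set.mem_ofPred_eq] at hf ⊢
    exact ⟨hf.1.comp_perm π, hπ f hf.2⟩
  · exact (π.surjective.injective_comp_right).injOn

theorem image_mirror_image_mirror {n : ℕ} {S : Finset ℕ} (hS : S ⊆ Finset.Icc 1 (n - 1)) :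
    (S.image (fun i => n - i)).image (fun i => n - i) = S := by
  rw [Finset.image_image]
  conv_rhs => rw [← Finset.image_id (s := S)]
  refine Finset.image_congr fun i hi => ?_
  have := Finset.mem_Icc.mp (hS hi)
  simp only [Function.comp_apply, id]
  omega

theorem card_desSet_subset_mirror {n : ℕ} {S : Finset ℕ} (hS : S ⊆ Finset.Icc 1 (n - 1)) :
    (Finset.univ.filter (fun f : Fin n → Fin n => IsPF f ∧ desSet f ⊆ ↑S)).card
      = (Finset.univ.filter (fun f : Fin n → Fin n =>
        IsPF f ∧ desSet f ⊆ ↑(S.image (fun i => n - i)))).card := by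
  refine le_antisymm ?_ (card_desSet_subset_mirror_le n S)
  have := card_desSet_subset_mirror_le n (S.image (fun i => n - i))
  rwa [image_mirror_image_mirror hS] at this

theorem card_desSet_subset_eq_sum (n : ℕ) (S : Finset ℕ) :
    (Finset.univ.filter (fun f : Fin n → Fin n => IsPF f ∧ desSet f ⊆ ↑S)).card
      = ∑ T ∈ S.powerset,
        (Finset.univ.filter (fun f : Fin n → Fin n => IsPF f ∧ desSet f = ↑T)).card := by
  rw [Finset.card_eq_sum_card_fiberwise (f := fun f => S.filter (· ∈ desSet f)) (t := S.powerset)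
    (fun f _ => Finset.mem_coe.mpr (Finset.mem_powerset.mpr (Finset.filter_subset _ _)))]
  refine Finset.sum_congr rfl fun T hT => congrArg Finset.card ?_
  have hTS := Finset.mem_powerset.mp hT
  ext f
  simp only [Finset.mem_filter, Finset.mem_univ, true_and]
  constructor
  · rintro ⟨⟨hf, hd⟩, rfl⟩
    refine ⟨hf, ?_⟩
    ext i
    simpa using fun h => hd h
  · rintro ⟨hf, hd⟩
    refine ⟨⟨hf, hd ▸ Finset.coe_subset.mpr hTS⟩, ?_⟩
    ext i
    simpa [hd] using fun h => hTS h

theorem sum_powerset_image_mirror {n : ℕ} {S : Finset ℕ} (hS : S ⊆ Finset.Icc 1 (n - 1))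
    (d : Finset ℕ → ℕ) :
    ∑ T ∈ (S.image (fun i => n - i)).powerset, d T
      = ∑ T ∈ S.powerset, d (T.image (fun i => n - i)) := by
  rw [Finset.powerset_image, Finset.sum_image]
  intro T hT T' hT' h
  have h1 := (Finset.mem_powerset.mp hT).trans hS
  have h2 := (Finset.mem_powerset.mp hT').trans hS
  rw [← image_mirror_image_mirror h1, ← image_mirror_image_mirror h2]
  exact congrArg (Finset.image (fun i => n - i)) h

/-- A function on the subsets of `U` is determined by its sums over power sets. -/
theorem eq_of_sum_powerset_eq {α : Type*} {U : Finset α} {d e : Finset α → ℕ}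
    (h : ∀ S ⊆ U, ∑ T ∈ S.powerset, d T = ∑ T ∈ S.powerset, e T) :
    ∀ S ⊆ U, d S = e S := by
  intro S
  induction S using Finset.strongInduction with
  | H S ih =>
    intro hS
    have hsum := h S hS
    rw [← Finset.sum_erase_add _ _ (Finset.mem_powerset_self S),
      ← Finset.sum_erase_add _ _ (Finset.mem_powerset_self S)] at hsum
    have hlow : ∑ T ∈ S.powerset.erase S, d T = ∑ T ∈ S.powerset.erase S, e T := by
      refine Finset.sum_congr rfl fun T hT => ?_
      obtain ⟨hne, hT⟩ := Finset.mem_erase.mp hT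
      have hTS := Finset.mem_powerset.mp hT
      exact ih T (hTS.ssubset_of_ne hne) (hTS.trans hS)
    omega

/-- For nonempty `I ⊆ [n-1]` and `J = {n - i : i ∈ I}`, the number of parking functions
of length `n` with descent set exactly `I` equals the number with descent set exactly `J`. -/
theorem stmt1 (n : ℕ) (hn : 1 ≤ n) (I : Finset ℕ) (hne : I.Nonempty)
    (hI : I ⊆ Finset.Icc 1 (n - 1)) :
    (Finset.univ.filter (fun f : Fin n → Fin n => IsPF f ∧ desSet f = ↑I)).card
      = (Finset.univ.filter (fun f : Fin n → Fin n =>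
          IsPF f ∧ desSet f = ↑(I.image (fun i => n - i)))).card := by
  let d : Finset ℕ → ℕ := fun T =>
    (Finset.univ.filter (fun f : Fin n → Fin n => IsPF f ∧ desSet f = ↑T)).card
  refine eq_of_sum_powerset_eq (U := Finset.Icc 1 (n - 1)) (d := d)
    (e := fun T => d (T.image (fun i => n - i))) (fun S hS => ?_) I hI
  rw [← sum_powerset_image_mirror hS d]
  exact (card_desSet_subset_eq_sum n S).symm.trans
    ((card_desSet_subset_mirror hS).trans (card_desSet_subset_eq_sum n _))
end

section
/- Let n ≥ 1 and 0 ≤ k ≤ n−1, and let I = [k] = {1,2,…,k} ⊆ [n-1]. Then n · d(I;n) = C(n,k) · C(2n−k, n−k−1), i.e., the number of parking functions of length n whose descent set is exactly {1,…,k} equals (1/n)·binomial(n,k)·binomial(2n−k, n−k−1). -/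
open scoped Classical

theorem isPF_iff {n : ℕ} (f : Fin n → Fin n) :
    IsPF f ↔ ∀ i ≤ n, i ≤ (Finset.univ.filter fun t => (f t : ℕ) < i).card := by
  constructor
  · rintro ⟨σ, -, hσ⟩ i hi
    have h := Finset.card_le_card_of_injOn (s := (Finset.univ : Finset (Fin i)))
      (t := Finset.univ.filter fun t => (f t : ℕ) < i) (fun s => σ (s.castLE hi))
      (fun s _ => by simpa using (hσ (s.castLE hi)).trans_lt s.2)
      (fun s _ t _ hst => by simpa using hst)
    simpa using h
  · intro h
    refine ⟨Tuple.sort f, Tuple.monotone_sort f, fun i => ?_⟩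
    by_contra! hi
    have h1 := h (i + 1) i.2
    have h2 : (Finset.univ.filter fun t => (f t : ℕ) < i + 1) ⊆
        (Finset.Iio i).map (Tuple.sort f).toEmbedding := by
      intro t ht
      simp only [Finset.mem_filter, Finset.mem_univ, true_and] at ht
      refine Finset.mem_map.2 ⟨(Tuple.sort f).symm t, ?_, by simp⟩
      by_contra! hlt
      have h3 := Tuple.monotone_sort f (not_lt.1 (fun hh => hlt (Finset.mem_Iio.2 hh)))
      have h4 : (f (Tuple.sort f i) : ℕ) ≤ f t := by simpa using h3
      omega
    have := Finset.card_le_card h2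
    rw [Finset.card_map, Fin.card_Iio] at this
    omega

/-- A multiset of `n` residues modulo `n + 1` is parking if, for all `i ≤ n`, at least `i` of
its elements are less than `i`. -/
def IsParking {n : ℕ} (T : Multiset (Fin (n + 1))) : Prop :=
  ∀ i ≤ n, i ≤ T.countP fun x : Fin (n + 1) => x.val < i

theorem countP_sub_lt {n : ℕ} (T : Multiset (Fin (n + 1))) (c : Fin (n + 1)) (i : ℕ)
    (hi : i ≤ n + 1) :
    T.countP (fun x => ((x - c : Fin (n + 1)) : ℕ) < i) =
      ∑ s ∈ Finset.range i, T.count (Fin.ofNat (n + 1) (c + s)) := by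
  induction i with
  | zero => simp
  | succ i ih =>
    have hkey : ∀ x : Fin (n + 1), (x - c).val = i ↔ x = Fin.ofNat (n + 1) (c + i) := by
      intro x
      have h1 : x = Fin.ofNat (n + 1) (c + i) ↔ x = c + Fin.ofNat (n + 1) i := by
        rw [Fin.ext_iff, Fin.ext_iff]
        simp [Fin.ofNat, Fin.val_add]
      rw [h1, ← sub_eq_iff_eq_add', Fin.ext_iff]
      simp [Fin.ofNat, Nat.mod_eq_of_lt (show i < n + 1 by omega)]
    rw [Finset.sum_range_succ, ← ih (by omega)]
    clear ih
    induction T using Multiset.induction_on with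
    | empty => simp
    | cons a T ih =>
      have := hkey a
      simp only [Multiset.countP_cons, Multiset.count_cons, ih]
      grind

theorem existsUnique_shift_parking {n : ℕ} (T : Multiset (Fin (n + 1))) (hT : T.card = n) :
    ∃! c : Fin (n + 1), IsParking (T.map (· - c)) := by
  set m : ℕ → ℤ := fun s => T.count (Fin.ofNat (n + 1) s)
  set W : ℕ → ℤ := fun t => ∑ s ∈ Finset.range t, (m s - 1) with hW
  have hper : ∀ t, m (t + (n + 1)) = m t := by
    intro t; simp [m, Fin.ofNat]
  have hWn : W (n + 1) = -1 := by
    have h := countP_sub_lt T 0 (n + 1) le_rfl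
    have h' : T.countP (fun x => ((x - 0 : Fin (n + 1)) : ℕ) < n + 1) = n := by
      rw [Multiset.countP_eq_card.2 (fun x _ => (x - 0).2), hT]
    rw [h'] at h
    simp only [hW, Finset.sum_sub_distrib, m]
    simp only [Fin.val_zero, zero_add] at h
    have h2 : (n : ℤ) = _ := congrArg Nat.cast h
    push_cast at h2
    simp only [Finset.sum_const, Finset.card_range, ← h2]
    simp
  have hWper : ∀ t, W (t + (n + 1)) = W t - 1 := by
    intro t
    induction t with
    | zero => simpa [hW] using hWn
    | succ t ih =>
      have h1 : W (t + 1) = W t + (m t - 1) := Finset.sum_range_succ _ _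
      have h2 : W (t + (n + 1) + 1) = W (t + (n + 1)) + (m (t + (n + 1)) - 1) :=
        Finset.sum_range_succ _ _
      rw [add_right_comm, h2, h1, ih, hper]; ring
  have hgood : ∀ c : Fin (n + 1), IsParking (T.map (· - c)) ↔ ∀ i ≤ n, W c ≤ W (c + i) := by
    intro c
    refine forall₂_congr fun i hi => ?_
    rw [Multiset.countP_map, ← Multiset.countP_eq_card_filter,
      countP_sub_lt T c i (by omega)]
    have : W (c + i) = W c + ∑ s ∈ Finset.range i, (m (c + s) - 1) := Finset.sum_range_add _ _ _
    rw [this, Finset.sum_sub_distrib]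
    simp only [m, Finset.sum_const, Finset.card_range]
    zify
    simp
  have hgood' : ∀ c : Fin (n + 1), IsParking (T.map (· - c)) ↔
      (∀ t ≤ n, W c ≤ W t) ∧ ∀ t < c.val, W c < W t := by
    intro c
    rw [hgood]
    constructor
    · intro h
      have h2 : ∀ t < c.val, W c < W t := by
        intro t ht
        have h1 := h (t + (n + 1) - c) (by omega)
        rw [show (c : ℕ) + (t + (n + 1) - c) = t + (n + 1) by omega, hWper] at h1
        omega
      refine ⟨fun t ht => ?_, h2⟩
      rcases lt_or_ge t c.val with h3 | h3
      · exact (h2 t h3).le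
      · simpa [h3] using h (t - c) (by omega)
    · rintro ⟨h1, h2⟩ i hi
      rcases le_or_gt (c + i : ℕ) n with h3 | h3
      · exact h1 _ h3
      · have h4 := h2 (c + i - (n + 1)) (by omega)
        have h5 := hWper (c + i - (n + 1))
        rw [show (c : ℕ) + i - (n + 1) + (n + 1) = c + i by omega] at h5
        omega
  simp only [hgood']
  have hex : ∃ c, c ≤ n ∧ ∀ t ≤ n, W c ≤ W t := by
    obtain ⟨c, hc, h⟩ := Finset.exists_min_image (Finset.range (n + 1)) W ⟨0, by simp⟩
    exact ⟨c, by simpa [Nat.lt_succ_iff] using hc, fun t ht => h t (by simpa [Nat.lt_succ_iff])⟩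
  have hs := Nat.find_spec hex
  have hs1 := hs.1
  refine ⟨⟨Nat.find hex, by omega⟩, ⟨hs.2, fun t ht => ?_⟩, ?_⟩
  · have ht' : t < Nat.find hex := ht
    by_contra! h
    exact Nat.find_min hex ht' ⟨by omega, fun u hu => h.trans (hs.2 u hu)⟩
  · rintro d ⟨h1, h2⟩
    apply Fin.ext
    show (d : ℕ) = Nat.find hex
    rcases lt_trichotomy (d : ℕ) (Nat.find hex) with h | h | h
    · exact absurd ⟨by omega, h1⟩ (Nat.find_min hex h)
    · exact h
    · have := h2 _ h
      have := hs.2 d (by omega)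
      omega

/-- Pairs of a `j`-element set and a multiset of size `m` that together form a parking
multiset. -/
noncomputable def parkingPairs (n j m : ℕ) : Finset (Finset (Fin (n + 1)) × Sym (Fin (n + 1)) m) :=
  (Finset.powersetCard j Finset.univ ×ˢ Finset.univ).filter fun p =>
    IsParking (p.1.val + (p.2 : Multiset (Fin (n + 1))))

theorem mem_parkingPairs {n j m : ℕ} {p : Finset (Fin (n + 1)) × Sym (Fin (n + 1)) m} :
    p ∈ parkingPairs n j m ↔
      p.1.card = j ∧ IsParking (p.1.val + (p.2 : Multiset (Fin (n + 1)))) := by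
  simp [parkingPairs]

theorem succ_mul_card_parkingPairs (j m : ℕ) :
    (j + m + 1) * (parkingPairs (j + m) j m).card =
      (j + m + 1).choose j * (j + 2 * m).choose m := by
  set N := j + m with hN
  let A : Finset (Finset (Fin (N + 1)) × Sym (Fin (N + 1)) m) :=
    Finset.powersetCard j Finset.univ ×ˢ Finset.univ
  let rot (c : Fin (N + 1)) (p : Finset (Fin (N + 1)) × Sym (Fin (N + 1)) m) :
      Finset (Fin (N + 1)) × Sym (Fin (N + 1)) m :=
    (p.1.map (Equiv.subRight c).toEmbedding, p.2.map (Equiv.subRight c))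
  let P (p : Finset (Fin (N + 1)) × Sym (Fin (N + 1)) m) : Prop :=
    IsParking (p.1.val + (p.2 : Multiset (Fin (N + 1))))
  have hA : A.card = (N + 1).choose j * (j + 2 * m).choose m := by
    rw [Finset.card_product, Finset.card_powersetCard, Finset.card_univ, Finset.card_univ,
      Sym.card_sym_eq_choose, Fintype.card_fin]
    congr 2
    omega
  have hrot : ∀ c p, (rot c p).1.val + ((rot c p).2 : Multiset (Fin (N + 1))) =
      (p.1.val + (p.2 : Multiset (Fin (N + 1)))).map (· - c) := by
    intro c p
    rw [Multiset.map_add]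
    rfl
  have hone : ∀ p ∈ A, (Finset.univ.filter fun c => P (rot c p)).card = 1 := by
    intro p hp
    have hp1 : p.1.card = j := (Finset.mem_powersetCard.1 (Finset.mem_product.1 hp).1).2
    rw [Finset.card_eq_one]
    obtain ⟨c, hc, huniq⟩ := existsUnique_shift_parking
      (p.1.val + (p.2 : Multiset (Fin (N + 1)))) (by simp [hp1, hN])
    refine ⟨c, Finset.ext fun d => ?_⟩
    simp only [P, hrot, Finset.mem_filter, Finset.mem_univ, true_and, Finset.mem_singleton]
    exact ⟨huniq d, fun h => h ▸ hc⟩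
  have hinv : ∀ c p, rot c (rot (-c) p) = p := by
    intro c p
    ext1
    · simp only [rot, Finset.map_map, ← Equiv.trans_toEmbedding]
      convert Finset.map_refl
      ext x
      simp
    · simp [rot, Sym.map_map]
  have hshift : ∀ c, (A.filter fun p => P (rot c p)).card = (parkingPairs N j m).card := by
    intro c
    refine Finset.card_bij' (fun p _ => rot c p) (fun p _ => rot (-c) p) ?_ ?_
      (fun p _ => by simpa using hinv (-c) p) (fun p _ => hinv c p)
    · intro p hp
      simpa [A, P, rot, parkingPairs] using hp
    · intro p hp
      have : P p := (Finset.mem_filter.1 hp).2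
      simp only [Finset.mem_filter, hinv, this]
      simpa [A, rot, parkingPairs] using (Finset.mem_filter.1 hp).1
  rw [← hA, A.card_eq_sum_ones, ← Finset.sum_congr rfl hone]
  simp only [Finset.card_filter]
  rw [Finset.sum_comm]
  simp only [← Finset.card_filter, hshift]
  simp

/-- Parking functions which strictly decrease on the first `j` positions and weakly increase on
the remaining ones. -/
noncomputable def valleyPF (n j : ℕ) : Finset (Fin n → Fin n) :=
  Finset.univ.filter fun f => IsPF f ∧ ∀ i, ∀ h : 1 ≤ i ∧ i < n,
    (i < j → f ⟨i, h.2⟩ < f ⟨i - 1, (Nat.sub_le i 1).trans_lt h.2⟩) ∧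
    (j < i → f ⟨i - 1, (Nat.sub_le i 1).trans_lt h.2⟩ ≤ f ⟨i, h.2⟩)

/-- Parking functions with descent set `{1, …, k}`. -/
noncomputable def initialDesPF (n k : ℕ) : Finset (Fin n → Fin n) :=
  Finset.univ.filter fun f => IsPF f ∧ desSet f = ↑(Finset.Icc 1 k)

theorem desSet_eq_Icc_iff {n k : ℕ} (hk : k < n) {α : Type*} [LT α] (f : Fin n → α) :
    desSet f = ↑(Finset.Icc 1 k) ↔ ∀ i, ∀ h : 1 ≤ i ∧ i < n,
      (f ⟨i, h.2⟩ < f ⟨i - 1, (Nat.sub_le i 1).trans_lt h.2⟩ ↔ i ≤ k) := by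
  rw [Set.ext_iff]
  refine forall_congr' fun i => ?_
  simp only [desSet, Finset.coe_Icc, Set.mem_Icc]
  constructor
  · intro h h'
    constructor
    · intro h2
      exact (h.1 ⟨h', h2⟩).2
    · intro h2
      exact (h.2 ⟨h'.1, h2⟩).2
  · intro h
    constructor
    · rintro ⟨h1, h2⟩
      exact ⟨h1.1, (h h1).1 h2⟩
    · rintro ⟨h1, h2⟩
      exact ⟨⟨h1, by omega⟩, (h ⟨h1, by omega⟩).2 h2⟩

theorem valleyPF_zero {n : ℕ} (hn : 0 < n) : valleyPF n 0 = initialDesPF n 0 := by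
  ext f
  simp only [valleyPF, initialDesPF, Finset.mem_filter, desSet_eq_Icc_iff hn]
  refine and_congr_right fun _ => and_congr_right fun _ => forall₂_congr fun i hi => ?_
  grind

theorem card_valleyPF_succ {n k : ℕ} (hk : k + 1 < n) :
    (valleyPF n (k + 1)).card = (initialDesPF n k).card + (initialDesPF n (k + 1)).card := by
  rw [← Finset.card_union_of_disjoint]
  · congr 1
    ext f
    simp only [valleyPF, initialDesPF, Finset.mem_filter, Finset.mem_union,
      desSet_eq_Icc_iff hk, desSet_eq_Icc_iff (show k < n by omega), Finset.mem_univ, true_and,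
      ← and_or_left]
    refine and_congr_right fun _ => ⟨fun h => ?_, ?_⟩
    · by_cases h' : f ⟨k + 1, hk⟩ < f ⟨k, by omega⟩
      · right
        intro i hi
        have := h i hi
        rcases lt_trichotomy i (k + 1) with h1 | rfl | h1
        · grind
        · simpa using h'
        · grind
      · left
        intro i hi
        have := h i hi
        rcases lt_trichotomy i (k + 1) with h1 | rfl | h1
        · grind
        · simpa using h'
        · grind
    · rintro (h | h) i hi <;> have := h i hi <;> grind
  · rw [Finset.disjoint_left]
    intro f h1 h2
    simp only [initialDesPF, Finset.mem_filter, desSet_eq_Icc_iff hk,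
      desSet_eq_Icc_iff (show k < n by omega)] at h1 h2
    have := h1.2.2 (k + 1) ⟨by omega, hk⟩
    have := h2.2.2 (k + 1) ⟨by omega, hk⟩
    grind

theorem isPF_iff_isParking {n : ℕ} (f : Fin n → Fin n) :
    IsPF f ↔ IsParking (Finset.univ.val.map (Fin.castSucc ∘ f)) := by
  rw [isPF_iff]
  refine forall₂_congr fun i _ => ?_
  rw [Multiset.countP_map, Finset.card_def]
  rfl

theorem strictAnti_castAdd_iff {j m : ℕ} {α : Type*} [Preorder α] (f : Fin (j + m) → α) :
    StrictAnti (f ∘ Fin.castAdd m) ↔ ∀ i, ∀ h : 1 ≤ i ∧ i < j + m,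
      i < j → f ⟨i, h.2⟩ < f ⟨i - 1, (Nat.sub_le i 1).trans_lt h.2⟩ := by
  cases j with
  | zero => exact ⟨fun _ i h h' => absurd h' (by omega), fun _ => Subsingleton.strictAnti _⟩
  | succ j =>
    rw [Fin.strictAnti_iff_succ_lt]
    constructor
    · rintro h (_ | i) hi hij
      · omega
      · exact h ⟨i, by omega⟩
    · intro h i
      exact h (i + 1) (by omega) (by omega)

theorem monotone_natAdd_iff {j m : ℕ} {α : Type*} [Preorder α] (f : Fin (j + m) → α) :
    Monotone (f ∘ Fin.natAdd j) ↔ ∀ i, ∀ h : 1 ≤ i ∧ i < j + m,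
      j < i → f ⟨i - 1, (Nat.sub_le i 1).trans_lt h.2⟩ ≤ f ⟨i, h.2⟩ := by
  cases m with
  | zero => exact ⟨fun _ i h h' => absurd h' (by omega), fun _ => Subsingleton.monotone _⟩
  | succ m =>
    rw [Fin.monotone_iff_le_succ]
    constructor
    · intro h i hi hij
      obtain ⟨d, rfl⟩ := Nat.exists_eq_add_of_lt hij
      exact h ⟨d, by omega⟩
    · intro h i
      exact h (j + i + 1) (by omega) (by omega)

theorem mem_valleyPF {j m : ℕ} {f : Fin (j + m) → Fin (j + m)} :
    f ∈ valleyPF (j + m) j ↔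
      IsPF f ∧ StrictAnti (f ∘ Fin.castAdd m) ∧ Monotone (f ∘ Fin.natAdd j) := by
  rw [strictAnti_castAdd_iff, monotone_natAdd_iff]
  simp only [valleyPF, Finset.mem_filter, Finset.mem_univ, true_and]
  grind

theorem univ_val_map_add {j m : ℕ} {α : Type*} (f : Fin (j + m) → α) :
    Finset.univ.val.map f = Finset.univ.val.map (f ∘ Fin.castAdd m) +
      Finset.univ.val.map (f ∘ Fin.natAdd j) := by
  rw [Fin.univ_val_map, Fin.univ_val_map, Fin.univ_val_map, List.ofFn_add]
  rfl

theorem monotone_eq_of_map_eq {m : ℕ} {α : Type*} [PartialOrder α] {f g : Fin m → α}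
    (hf : Monotone f) (hg : Monotone g) (h : Finset.univ.val.map f = Finset.univ.val.map g) :
    f = g := by
  rw [Fin.univ_val_map, Fin.univ_val_map, Multiset.coe_eq_coe] at h
  exact List.ofFn_injective
    (h.eq_of_sortedLE (List.sortedLE_ofFn_iff.2 hf) (List.sortedLE_ofFn_iff.2 hg))

theorem exists_monotone_map_eq {m : ℕ} {α : Type*} [LinearOrder α] (s : Multiset α)
    (hs : s.card = m) : ∃ f : Fin m → α, Monotone f ∧ Finset.univ.val.map f = s := by
  subst hs
  refine ⟨fun i => (s.sort).get (i.cast (by simp)), ?_, ?_⟩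
  · intro a b hab
    exact (Multiset.pairwise_sort s (· ≤ ·)).sortedLE.monotone_get hab
  · rw [Fin.univ_val_map]
    conv_rhs => rw [← Multiset.sort_eq s (· ≤ ·)]
    congr 1
    apply List.ext_get <;> simp

theorem card_valleyPF (j m : ℕ) :
    (valleyPF (j + m) j).card = (parkingPairs (j + m) j m).card := by
  have hval : ∀ f : Fin (j + m) → Fin (j + m + 1), StrictAnti (f ∘ Fin.castAdd m) →
      (Finset.univ.image (f ∘ Fin.castAdd m)).val = Finset.univ.val.map (f ∘ Fin.castAdd m) :=
    fun f hf => Finset.image_val_of_injOn hf.injective.injOn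
  refine Finset.card_bij (fun f _ =>
    (Finset.univ.image (Fin.castSucc ∘ f ∘ Fin.castAdd m),
      ⟨Finset.univ.val.map (Fin.castSucc ∘ f ∘ Fin.natAdd j), by simp⟩)) ?_ ?_ ?_
  · intro f hf
    obtain ⟨h1, h2, h3⟩ := mem_valleyPF.1 hf
    have h2' : StrictAnti (Fin.castSucc ∘ f ∘ Fin.castAdd m) :=
      (Fin.strictMono_castSucc).comp_strictAnti h2
    rw [isPF_iff_isParking, univ_val_map_add, ← hval _ h2'] at h1
    exact mem_parkingPairs.2 ⟨by simp [Finset.card_image_of_injective _ h2'.injective], h1⟩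
  · intro f hf g hg hfg
    obtain ⟨-, hf2, hf3⟩ := mem_valleyPF.1 hf
    obtain ⟨-, hg2, hg3⟩ := mem_valleyPF.1 hg
    have hf2' := (Fin.strictMono_castSucc (n := j + m)).comp_strictAnti hf2
    have hg2' := (Fin.strictMono_castSucc (n := j + m)).comp_strictAnti hg2
    have e1 := congrArg (fun p => p.1.val) hfg
    replace e1 := (hval (Fin.castSucc ∘ f) hf2').symm.trans (e1.trans
      (hval (Fin.castSucc ∘ g) hg2'))
    have e1' := monotone_eq_of_map_eq (α := (Fin (j + m + 1))ᵒᵈ) hf2'.antitone hg2'.antitone e1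
    have e2 := monotone_eq_of_map_eq (Fin.strictMono_castSucc.monotone.comp hf3)
      (Fin.strictMono_castSucc.monotone.comp hg3)
      (congrArg (fun p => p.2.val) hfg)
    funext x
    refine Fin.addCases (fun i => ?_) (fun i => ?_) x
    · simpa using congrFun e1' i
    · simpa using congrFun e2 i
  · rintro ⟨S, M, hM⟩ hp
    obtain ⟨hS, hpark⟩ := mem_parkingPairs.1 hp
    obtain ⟨g, hg, hgS⟩ := exists_monotone_map_eq (α := (Fin (j + m + 1))ᵒᵈ) S.val hS
    obtain ⟨h, hh, hhM⟩ := exists_monotone_map_eq M hM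
    let F : Fin (j + m) → Fin (j + m + 1) := Fin.append g h
    have hFg : F ∘ Fin.castAdd m = g :=
      funext fun i => Fin.append_left (α := Fin (j + m + 1)) g h i
    have hFh : F ∘ Fin.natAdd j = h :=
      funext fun i => Fin.append_right (α := Fin (j + m + 1)) g h i
    have hF : Finset.univ.val.map F = S.val + M := by
      rw [univ_val_map_add, hFg, hFh, hhM]; exact congrArg (· + M) hgS
    have hlt : ∀ i, (F i).val < j + m := by
      have h1 := hpark (j + m) le_rfl
      change _ ≤ Multiset.countP _ (S.val + M) at h1
      rw [← hF] at h1
      have h2 := Multiset.countP_eq_card.1 (le_antisymm (Multiset.countP_le_card _ _)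
        ((by simp : (Finset.univ.val.map F).card = j + m).trans_le h1))
      exact fun i => h2 _ (Multiset.mem_map_of_mem F (Finset.mem_univ i))
    let f : Fin (j + m) → Fin (j + m) := fun i => ⟨F i, hlt i⟩
    have hfF : Fin.castSucc ∘ f = F := rfl
    have hginj : Function.Injective g := by
      have : (Finset.univ.val.map g).Nodup := hgS ▸ S.nodup
      exact fun a b hab =>
        Multiset.inj_on_of_nodup_map this a (Finset.mem_univ a)
        b (Finset.mem_univ b) hab
    refine ⟨f, mem_valleyPF.2 ⟨?_, ?_, ?_⟩, ?_⟩
    · rw [isPF_iff_isParking, hfF, hF]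
      exact hpark
    · intro a b hab
      have := (hg.strictMono_of_injective hginj) hab
      rw [← hFg] at this
      exact this
    · intro a b hab
      have := hh hab
      rw [← hFh] at this
      exact this
    · refine Prod.ext ?_ (Subtype.ext ?_)
      · apply Finset.val_injective
        change (Finset.univ.image (F ∘ Fin.castAdd m)).val = S.val
        rw [Finset.image_val_of_injOn (hFg ▸ hginj).injOn, hFg]
        exact hgS
      · change Finset.univ.val.map (F ∘ Fin.natAdd j) = M
        rw [hFh, hhM]

theorem succ_mul_card_valleyPF (j m : ℕ) :
    (j + m + 1) * (valleyPF (j + m) j).card =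
      (j + m + 1).choose j * (j + 2 * m).choose m := by
  rw [card_valleyPF, succ_mul_card_parkingPairs]

theorem mul_card_initialDesPF (k m : ℕ) :
    (k + m + 1) * (initialDesPF (k + m + 1) k).card =
      (k + m + 1).choose k * (k + 2 * m + 2).choose m := by
  induction k generalizing m with
  | zero =>
    rw [← valleyPF_zero (by omega)]
    have h := succ_mul_card_valleyPF 0 (m + 1)
    have h2 := Nat.choose_succ_right_eq (2 * m + 2) m
    simp only [zero_add, Nat.choose_zero_right, one_mul, Nat.mul_add, mul_one] at *
    rw [show 2 * m + 2 - m = m + 1 + 1 by omega] at h2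
    apply Nat.eq_of_mul_eq_mul_left (show 0 < m + 1 + 1 by omega)
    linear_combination (m + 1) * h + h2
  | succ k ih =>
    have h1 := card_valleyPF_succ (n := k + 1 + m + 1) (k := k) (by omega)
    have h2 := succ_mul_card_valleyPF (k + 1) (m + 1)
    have h3 := ih (m + 1)
    rw [show k + (m + 1) + 1 = k + 1 + m + 1 by ring] at h3
    rw [show k + 1 + (m + 1) = k + 1 + m + 1 by ring] at h2
    have c1 := Nat.choose_succ_right_eq (k + 1 + 2 * (m + 1)) m
    have c2 := Nat.choose_succ_succ (k + 1 + 2 * (m + 1)) m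
    have c3 := Nat.add_one_mul_choose_eq (k + 1 + m + 1) k
    rw [show k + 1 + 2 * (m + 1) - m = k + m + 3 by omega] at c1
    have c4 := Nat.choose_succ_succ (k + 1 + m + 1) k
    rw [show k + 2 * (m + 1) + 2 = k + 1 + 2 * (m + 1) + 1 by ring] at h3
    rw [show k + 1 + 2 * m + 2 = k + 1 + 2 * (m + 1) by ring]
    simp only [Nat.succ_eq_add_one] at c2 c4
    rw [h1] at h2
    rw [c2] at h3
    rw [c4] at h2 c3
    apply Nat.eq_of_mul_eq_mul_left (show 0 < k + 1 + m + 1 + 1 by omega)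
    generalize (k + 1 + 2 * (m + 1)).choose m = Y at *
    generalize (k + 1 + 2 * (m + 1)).choose (m + 1) = X at *
    generalize (k + 1 + m + 1).choose k = C at *
    generalize (k + 1 + m + 1).choose (k + 1) = D at *
    zify at *
    linear_combination (k + m + 2 : ℤ) * h2 - (k + m + 3 : ℤ) * h3 - (X : ℤ) * c3 +
      (C + D : ℤ) * c1

/-- The number of parking functions of length `n` with descent set exactly
`[k] = {1,…,k}` is `(1/n)·C(n,k)·C(2n−k, n−k−1)`. -/
theorem stmt6 (n k : ℕ) (hn : 1 ≤ n) (hk : k ≤ n - 1) :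
    n * (Finset.univ.filter (fun f : Fin n → Fin n =>
        IsPF f ∧ desSet f = ↑(Finset.Icc 1 k))).card
      = Nat.choose n k * Nat.choose (2 * n - k) (n - k - 1) := by
  obtain ⟨m, rfl⟩ : ∃ m, n = k + m + 1 := ⟨n - k - 1, by omega⟩
  rw [show 2 * (k + m + 1) - k = k + 2 * m + 2 by omega, show k + m + 1 - k - 1 = m by omega]
  exact mul_card_initialDesPF k m
end

section
/- For every n ≥ 1, the set PF↑_n of nondecreasing parking functions of length n and the set PTPF_n of peakless-tieless parking functions of length n have the same cardinality (there is a bijection φ : PF↑_n → PTPF_n). -/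
open scoped Classical

/-- The (1-indexed) peak set of a tuple `a_1, …, a_k`: the indices `i` with
`2 ≤ i ≤ k-1` and `a_{i-1} < a_i > a_{i+1}`.  (Here `a_i = f ⟨i-1, _⟩`.) -/
def peakSet {k : ℕ} {α : Type*} [LT α] (f : Fin k → α) : Set ℕ :=
  {i | ∃ h : 2 ≤ i ∧ i < k,
    f ⟨i - 2, (Nat.sub_le i 2).trans_lt h.2⟩ < f ⟨i - 1, (Nat.sub_le i 1).trans_lt h.2⟩ ∧
    f ⟨i, h.2⟩ < f ⟨i - 1, (Nat.sub_le i 1).trans_lt h.2⟩}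

/-- The (1-indexed) tie set of a tuple `a_1, …, a_k`: the indices `i ∈ [k-1]`
with `a_i = a_{i+1}`.  (Here `a_i = f ⟨i-1, _⟩`.) -/
def tieSet {k : ℕ} {α : Type*} (f : Fin k → α) : Set ℕ :=
  {i | ∃ h : 1 ≤ i ∧ i < k, f ⟨i - 1, (Nat.sub_le i 1).trans_lt h.2⟩ = f ⟨i, h.2⟩}

lemma isPF_iff_forall_lt_card {n : ℕ} (f : Fin n → Fin n) :
    IsPF f ↔ ∀ i : Fin n, (i : ℕ) < (Finset.univ.filter fun j => f j ≤ i).card := by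
  constructor
  · rintro ⟨σ, hmono, hle⟩ i
    have hsub : (Finset.Iic i).map σ.toEmbedding ⊆ Finset.univ.filter fun j => f j ≤ i := by
      intro j hj
      obtain ⟨k, hk, rfl⟩ := Finset.mem_map.1 hj
      simpa using (hmono (Finset.mem_Iic.1 hk)).trans (hle i)
    have := Finset.card_le_card hsub
    rw [Finset.card_map, Fin.card_Iic] at this
    omega
  · intro h
    refine ⟨Tuple.sort f, Tuple.monotone_sort f, fun i => ?_⟩
    by_contra! hlt
    have hsub : (Finset.univ.filter fun j => f j ≤ i) ⊆
        (Finset.Iio i).map (Tuple.sort f).toEmbedding := by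
      intro j hj
      refine Finset.mem_map.2 ⟨(Tuple.sort f).symm j, ?_, by simp⟩
      rw [Finset.mem_Iio]
      by_contra! hij
      have h1 := Tuple.monotone_sort f hij
      have h2 := (Finset.mem_filter.1 hj).2
      simp only [Function.comp_apply, Equiv.apply_symm_apply] at h1
      exact absurd (h1.trans h2) (not_le.2 hlt)
    have := Finset.card_le_card hsub
    rw [Finset.card_map, Fin.card_Iio] at this
    exact absurd (h i) (not_lt.2 this)

/-- For a monotone `g`, at least `i + 1` entries lie below `c` iff the entry at `i` does. -/
lemma lt_card_filter_le_iff_of_monotone {n : ℕ} {α : Type*} [LinearOrder α] {g : Fin n → α}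
    (hg : Monotone g) (i : Fin n) (c : α) :
    (i : ℕ) < (Finset.univ.filter fun j => g j ≤ c).card ↔ g i ≤ c := by
  constructor
  · intro h
    by_contra! hlt
    have hsub : (Finset.univ.filter fun j => g j ≤ c) ⊆ Finset.Iio i := by
      intro j hj
      rw [Finset.mem_Iio]
      by_contra! hij
      exact absurd ((hg hij).trans (Finset.mem_filter.1 hj).2) (not_le.2 hlt)
    have := Finset.card_le_card hsub
    rw [Fin.card_Iio] at this
    omega
  · intro h
    have hsub : Finset.Iic i ⊆ Finset.univ.filter fun j => g j ≤ c := by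
      intro j hj
      simpa using (hg (Finset.mem_Iic.1 hj)).trans h
    have := Finset.card_le_card hsub
    rw [Fin.card_Iic] at this
    omega

/-- Strictly increasing sequences of length `n` correspond to `n`-element sets. -/
lemma ncard_strictMono_eq_ncard_finset {n : ℕ} {α : Type*} [LinearOrder α]
    (P : Finset α → Prop) :
    {g : Fin n → α | StrictMono g ∧ P (Finset.univ.image g)}.ncard =
      {A : Finset α | A.card = n ∧ P A}.ncard := by
  have hbij : Set.BijOn (fun g : Fin n → α => Finset.univ.image g)
      {g | StrictMono g ∧ P (Finset.univ.image g)} {A | A.card = n ∧ P A} := by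
    refine ⟨?_, ?_, ?_⟩
    · rintro g ⟨hg, hP⟩
      exact ⟨by rw [Finset.card_image_of_injective _ hg.injective]; simp, hP⟩
    · rintro g ⟨hg, -⟩ g' ⟨hg', -⟩ h
      refine (StrictMono.range_inj hg hg').1 ?_
      simpa using congrArg (fun A : Finset α => (A : Set α)) h
    · rintro A ⟨hA, hP⟩
      have himage : Finset.univ.image (A.orderEmbOfFin hA) = A := by
        apply Finset.coe_injective
        simp
      exact ⟨A.orderEmbOfFin hA, ⟨(A.orderEmbOfFin hA).strictMono, by rwa [himage]⟩, himage⟩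
  rw [← hbij.image_eq, hbij.injOn.ncard_image]

/-- The enumeration `0, -1, 1, -2, 2, …` of the integers. -/
def zigzag : ℕ ≃ ℤ where
  toFun a := if a % 2 = 0 then (a / 2 : ℕ) else -((a / 2 : ℕ) + 1)
  invFun z := if 0 ≤ z then 2 * z.natAbs else 2 * z.natAbs - 1
  left_inv a := by
    dsimp only
    split_ifs <;> omega
  right_inv z := by
    dsimp only
    split_ifs <;> omega

lemma natAbs_zigzag_le_iff (a i : ℕ) : (zigzag a).natAbs ≤ i ↔ a ≤ 2 * i := by
  simp only [zigzag, Equiv.coe_fn_mk]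
  split_ifs <;> omega

lemma ncard_finset_nat_eq_ncard_finset_int (n : ℕ) :
    {A : Finset ℕ | A.card = n ∧ ∀ i < n, i < (A.filter fun a => a ≤ 2 * i).card}.ncard =
      {C : Finset ℤ | C.card = n ∧ ∀ i < n, i < (C.filter fun c => c.natAbs ≤ i).card}.ncard := by
  rw [← Set.ncard_image_of_injective _ zigzag.finsetCongr.injective]
  congr 1
  ext C
  obtain ⟨A, rfl⟩ := zigzag.finsetCongr.surjective C
  rw [zigzag.finsetCongr.injective.mem_set_image]
  simp [Equiv.finsetCongr_apply, Finset.filter_map, natAbs_zigzag_le_iff]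

lemma card_filter_image_of_strictMono {n : ℕ} {α : Type*} [LinearOrder α] {g : Fin n → α}
    (hg : StrictMono g) (q : α → Prop) [DecidablePred q] :
    ((Finset.univ.image g).filter q).card = (Finset.univ.filter fun j => q (g j)).card := by
  rw [Finset.filter_image, Finset.card_image_of_injective _ hg.injective]

lemma ncard_monotone_isPF (n : ℕ) :
    {f : Fin n → Fin n | IsPF f ∧ Monotone f}.ncard =
      {g : Fin n → ℕ | StrictMono g ∧
        ∀ i < n, i < ((Finset.univ.image g).filter fun a => a ≤ 2 * i).card}.ncard := by
  have hbij : Set.BijOn (fun (f : Fin n → Fin n) (i : Fin n) => (f i + i : ℕ))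
      {f | IsPF f ∧ Monotone f} {g : Fin n → ℕ | StrictMono g ∧
        ∀ i < n, i < ((Finset.univ.image g).filter fun a => a ≤ 2 * i).card} := by
    refine ⟨?_, ?_, ?_⟩
    · rintro f ⟨hf, hmono⟩
      have hg : StrictMono fun i : Fin n => (f i + i : ℕ) := fun i j hij =>
        add_lt_add_of_le_of_lt (hmono hij.le) hij
      refine ⟨hg, fun i hi => ?_⟩
      have hle := (lt_card_filter_le_iff_of_monotone hmono ⟨i, hi⟩ _).1
        ((isPF_iff_forall_lt_card f).1 hf ⟨i, hi⟩)
      dsimp only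
      rw [card_filter_image_of_strictMono hg]
      refine (lt_card_filter_le_iff_of_monotone hg.monotone ⟨i, hi⟩ (2 * i)).2 ?_
      rw [Fin.le_def] at hle
      dsimp only at hle ⊢
      omega
    · rintro f - f' - h
      funext i
      have := congrFun h i
      dsimp only at this
      omega
    · rintro g ⟨hg, hcount⟩
      have hle (i : Fin n) : g i ≤ 2 * i := by
        have := hcount i i.2
        rwa [card_filter_image_of_strictMono hg, lt_card_filter_le_iff_of_monotone hg.monotone] at this
      have hstep (i j : Fin n) (hij : i ≤ j) : g i + (j - i : ℕ) ≤ g j := by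
        obtain ⟨j, hj⟩ := j
        induction j with
        | zero =>
          obtain rfl : i = ⟨0, hj⟩ := Fin.ext (by simpa [Fin.le_def] using hij)
          simp
        | succ j ih =>
          rcases hij.eq_or_lt with rfl | hlt
          · simp
          · have h1 := ih (Nat.lt_of_succ_lt hj) (Fin.le_def.2 (Nat.le_of_lt_succ (Fin.lt_def.1 hlt)))
            have h2 : g ⟨j, by omega⟩ < g ⟨j + 1, hj⟩ := hg (by simp)
            dsimp only at h1 ⊢
            omega
      have hge (i : Fin n) : (i : ℕ) ≤ g i := by
        have := hstep ⟨0, i.pos⟩ i (by simp [Fin.le_def])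
        dsimp only at this
        omega
      have hmono : Monotone fun i : Fin n => (⟨g i - i, by have := hle i; omega⟩ : Fin n) := by
        intro i j hij
        have h1 := hstep i j hij
        have h2 := hge i
        rw [Fin.le_def] at hij ⊢
        dsimp only
        omega
      refine ⟨fun i => ⟨g i - i, by have := hle i; omega⟩, ⟨?_, hmono⟩, ?_⟩
      · rw [isPF_iff_forall_lt_card]
        intro i
        rw [lt_card_filter_le_iff_of_monotone hmono, Fin.le_def]
        have := hle i
        dsimp only
        omega
      · funext i
        have := hge i
        dsimp only
        omega
  rw [← hbij.image_eq, hbij.injOn.ncard_image]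

lemma peakSet_eq_empty_iff {k : ℕ} {α : Type*} [LT α] (f : Fin k → α) :
    peakSet f = ∅ ↔ ∀ (i : ℕ) (h : i + 2 < k),
      ¬ (f ⟨i, by omega⟩ < f ⟨i + 1, by omega⟩ ∧ f ⟨i + 2, h⟩ < f ⟨i + 1, by omega⟩) := by
  rw [Set.eq_empty_iff_forall_notMem]
  constructor
  · intro h i hi hpeak
    exact h (i + 2) ⟨⟨by omega, hi⟩, hpeak⟩
  · rintro h i ⟨⟨h2, hi⟩, hpeak⟩
    obtain ⟨i, rfl⟩ := Nat.exists_eq_add_of_le' h2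
    exact h i hi hpeak

lemma tieSet_eq_empty_iff {k : ℕ} {α : Type*} (f : Fin k → α) :
    tieSet f = ∅ ↔ ∀ (i : ℕ) (h : i + 1 < k), f ⟨i, by omega⟩ ≠ f ⟨i + 1, h⟩ := by
  rw [Set.eq_empty_iff_forall_notMem]
  constructor
  · intro h i hi htie
    exact h (i + 1) ⟨⟨by omega, hi⟩, htie⟩
  · rintro h i ⟨⟨h1, hi⟩, htie⟩
    obtain ⟨i, rfl⟩ := Nat.exists_eq_add_of_le' h1
    exact h i hi htie

lemma Fin.strictMono_of_lt_add_one {n : ℕ} {α : Type*} [Preorder α] {g : Fin n → α}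
    (h : ∀ (i : ℕ) (hi : i + 1 < n), g ⟨i, by omega⟩ < g ⟨i + 1, hi⟩) : StrictMono g := by
  cases n with
  | zero => exact fun i => i.elim0
  | succ n => exact Fin.strictMono_iff_lt_succ.2 fun i => h i (by omega)

/-- Negate the entries of `f` that precede its first zero. -/
noncomputable def signed {n : ℕ} (f : Fin n → Fin n) (i : Fin n) : ℤ :=
  if ∃ j ≤ i, (f j : ℕ) = 0 then (f i : ℕ) else -(f i : ℕ)

lemma natAbs_signed {n : ℕ} (f : Fin n → Fin n) (i : Fin n) : (signed f i).natAbs = f i := by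
  unfold signed
  split_ifs <;> simp

lemma strictMono_signed {n : ℕ} {f : Fin n → Fin n} {p : Fin n} (hp : (f p : ℕ) = 0)
    (hpeak : peakSet f = ∅) (htie : tieSet f = ∅) : StrictMono (signed f) := by
  rw [peakSet_eq_empty_iff] at hpeak
  rw [tieSet_eq_empty_iff] at htie
  have hup (i : ℕ) (hpi : p ≤ i) (hi : i + 1 < n) : f ⟨i, by omega⟩ < f ⟨i + 1, hi⟩ := by
    induction i, hpi using Nat.le_induction with
    | base =>
      have := htie p hi
      rw [ne_eq, Fin.ext_iff] at this
      rw [Fin.lt_def]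
      simp only [Fin.eta] at this ⊢
      omega
    | succ i hpi ih =>
      have h1 := ih (by omega)
      exact lt_of_le_of_ne (not_lt.1 fun h2 => hpeak i hi ⟨h1, h2⟩) (htie _ hi)
  have hdown (d i : ℕ) (hd : i + 1 + d = p) : f ⟨i + 1, by omega⟩ < f ⟨i, by omega⟩ := by
    induction d generalizing i with
    | zero =>
      have hpi : (⟨i + 1, by omega⟩ : Fin n) = p := Fin.ext (by simpa using hd)
      have := htie i (by omega)
      rw [hpi, ne_eq, Fin.ext_iff] at this
      rw [hpi, Fin.lt_def]
      omega
    | succ d ih =>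
      have h1 := ih (i + 1) (by omega)
      exact lt_of_le_of_ne (not_lt.1 fun h2 => hpeak i (by omega) ⟨h2, h1⟩)
        (htie i (by omega)).symm
  refine Fin.strictMono_of_lt_add_one fun i hi => ?_
  have hpos (j : ℕ) (hjp : j < p) : 0 < (f ⟨j, by omega⟩ : ℕ) :=
    (Nat.zero_le _).trans_lt (Fin.lt_def.1 (hdown ((p : ℕ) - 1 - j) j (by omega)))
  have hsign (j : Fin n) : (∃ k ≤ j, (f k : ℕ) = 0) ↔ p ≤ j := by
    constructor
    · rintro ⟨k, hkj, hk⟩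
      by_contra! hlt
      exact (hpos k (by omega)).ne' hk
    · exact fun h => ⟨p, h, hp⟩
  simp only [signed, hsign]
  simp only [Fin.le_def]
  split_ifs with h1 h2 h2
  · exact_mod_cast hup i h1 hi
  · omega
  · have := hpos i (by omega)
    omega
  · have := Fin.lt_def.1 (hdown ((p : ℕ) - 1 - i) i (by omega))
    omega

lemma signed_natAbs_of_strictMono {n : ℕ} {h : Fin n → ℤ} (hh : StrictMono h) {p : Fin n}
    (hp : h p = 0) (hlt : ∀ i, (h i).natAbs < n) :
    (signed fun i => ⟨(h i).natAbs, hlt i⟩) = h := by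
  funext i
  have hsign : (∃ j ≤ i, (h j).natAbs = 0) ↔ 0 ≤ h i := by
    constructor
    · rintro ⟨j, hji, hj⟩
      have := hh.monotone hji
      omega
    · intro h0
      exact ⟨p, hh.le_iff_le.1 (hp ▸ h0), by simp [hp]⟩
  simp only [signed, hsign]
  split_ifs <;> omega

lemma ncard_peakless_tieless_isPF {n : ℕ} (hn : 1 ≤ n) :
    {f : Fin n → Fin n | IsPF f ∧ peakSet f = ∅ ∧ tieSet f = ∅}.ncard =
      {h : Fin n → ℤ | StrictMono h ∧
        ∀ i < n, i < ((Finset.univ.image h).filter fun c => c.natAbs ≤ i).card}.ncard := by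
  have hbij : Set.BijOn signed
      {f : Fin n → Fin n | IsPF f ∧ peakSet f = ∅ ∧ tieSet f = ∅} {h : Fin n → ℤ | StrictMono h ∧
        ∀ i < n, i < ((Finset.univ.image h).filter fun c => c.natAbs ≤ i).card} := by
    refine ⟨?_, ?_, ?_⟩
    · rintro f ⟨hf, hpeak, htie⟩
      rw [isPF_iff_forall_lt_card] at hf
      obtain ⟨p, hp⟩ := Finset.card_pos.1 (hf ⟨0, hn⟩)
      have hp0 : (f p : ℕ) = 0 := by simpa [Fin.le_def] using hp
      have hmono := strictMono_signed hp0 hpeak htie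
      refine ⟨hmono, fun i hi => ?_⟩
      rw [card_filter_image_of_strictMono hmono]
      simpa only [natAbs_signed, Fin.le_def] using hf ⟨i, hi⟩
    · rintro f - f' - h
      funext i
      apply Fin.ext
      rw [← natAbs_signed f, ← natAbs_signed f', h]
    · rintro h ⟨hmono, hcount⟩
      simp only [card_filter_image_of_strictMono hmono] at hcount
      obtain ⟨p, hp⟩ := Finset.card_pos.1 (hcount 0 hn)
      have hp0 : h p = 0 := by simpa using hp
      have hlt (i : Fin n) : (h i).natAbs < n := by
        have hall : (Finset.univ.filter fun j => (h j).natAbs ≤ n - 1) = Finset.univ := by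
          rw [← Finset.card_eq_iff_eq_univ]
          have h1 := hcount (n - 1) (by omega)
          have h2 := Finset.card_le_univ (Finset.univ.filter fun j => (h j).natAbs ≤ n - 1)
          rw [Fintype.card_fin] at h2 ⊢
          omega
        have := (Finset.mem_filter.1 (hall ▸ Finset.mem_univ i)).2
        omega
      refine ⟨fun i => ⟨(h i).natAbs, hlt i⟩, ⟨?_, ?_, ?_⟩,
        signed_natAbs_of_strictMono hmono hp0 hlt⟩
      · rw [isPF_iff_forall_lt_card]
        intro i
        simpa only [Fin.le_def] using hcount i i.2
      · rw [peakSet_eq_empty_iff]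
        rintro i hi ⟨h1, h2⟩
        have h3 : h ⟨i, by omega⟩ < h ⟨i + 1, by omega⟩ := hmono (by simp)
        have h4 : h ⟨i + 1, by omega⟩ < h ⟨i + 2, hi⟩ := hmono (by simp)
        rw [Fin.lt_def] at h1 h2
        dsimp only at h1 h2
        omega
      · rw [tieSet_eq_empty_iff]
        intro i hi heq
        have h3 : h ⟨i, by omega⟩ < h ⟨i + 1, hi⟩ := hmono (by simp)
        rw [Fin.ext_iff] at heq
        dsimp only at heq
        rcases lt_trichotomy p ⟨i, by omega⟩ with hpi | hpi | hpi
        · have := hmono hpi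
          omega
        · rw [← hpi] at h3 heq
          omega
        · have : h ⟨i + 1, hi⟩ ≤ h p := hmono.monotone (Nat.succ_le_of_lt (Fin.lt_def.1 hpi))
          omega
  rw [← hbij.image_eq, hbij.injOn.ncard_image]

/-- The set of nondecreasing parking functions of length `n` and the set of
peakless-tieless parking functions of length `n` have the same cardinality. -/
theorem stmt7 (n : ℕ) (hn : 1 ≤ n) :
    (Finset.univ.filter (fun f : Fin n → Fin n => IsPF f ∧ Monotone f)).card
      = (Finset.univ.filter (fun f : Fin n → Fin n =>
          IsPF f ∧ peakSet f = ∅ ∧ tieSet f = ∅)).card := by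
  have hfinset (q : (Fin n → Fin n) → Prop) [DecidablePred q] :
       (Finset.univ.filter q).card = {f | q f}.ncard := by
    rw [← Set.ncard_coe_finset]
    simp
  rw [hfinset, hfinset, ncard_monotone_isPF, ncard_peakless_tieless_isPF hn,
    ncard_strictMono_eq_ncard_finset
      fun A : Finset ℕ => ∀ i < n, i < (A.filter fun a => a ≤ 2 * i).card,
    ncard_strictMono_eq_ncard_finset
      fun C : Finset ℤ => ∀ i < n, i < (C.filter fun c => c.natAbs ≤ i).card]
  exact ncard_finset_nat_eq_ncard_finset_int n
end

section
/- For every n ≥ 2, the number of parking functions of length n with no peaks and exactly n−2 ties equals n(n−1). (Such a parking function consists of two constant blocks; the paper misprints the value as n(n+1), but its own proof and data table give n(n−1): 2, 6, 12, 20, 30 for n = 2,…,6.) -/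
open scoped Classical

/-- The tuple equal to `a` in its first `m` entries and to `b` afterwards. -/
def twoBlock {n : ℕ} {α : Type*} (m : ℕ) (a b : α) (i : Fin n) : α :=
  if (i : ℕ) < m then a else b

lemma tieSet_twoBlock {n m : ℕ} {α : Type*} {a b : α} (hab : a ≠ b) :
    tieSet (twoBlock m a b : Fin n → α) = ↑((Finset.Icc 1 (n - 1)).erase m) := by
  ext i
  simp only [tieSet, twoBlock, Set.mem_ofPred_eq, Finset.coe_erase, Finset.coe_Icc,
    Set.mem_sdiff, Set.mem_Icc, Set.mem_singleton_iff]
  constructor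
  · rintro ⟨h, e⟩
    refine ⟨by omega, ?_⟩
    rintro rfl
    rw [if_pos (by omega), if_neg (by omega)] at e
    exact hab e
  · rintro ⟨h, hm⟩
    refine ⟨by omega, ?_⟩
    by_cases hi : i < m
    · rw [if_pos (by omega), if_pos hi]
    · rw [if_neg (by omega), if_neg hi]

lemma ncard_tieSet_twoBlock {n m : ℕ} {α : Type*} {a b : α} (hab : a ≠ b)
    (h0 : 0 < m) (hm : m < n) :
    (tieSet (twoBlock m a b : Fin n → α)).ncard = n - 2 := by
  rw [tieSet_twoBlock hab, Set.ncard_coe_finset,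
    Finset.card_erase_of_mem (Finset.mem_Icc.2 ⟨h0, by omega⟩), Nat.card_Icc]
  omega

lemma peakSet_twoBlock {n m : ℕ} {α : Type*} [Preorder α] (a b : α) :
    peakSet (twoBlock m a b : Fin n → α) = ∅ := by
  ext i
  simp only [peakSet, twoBlock, Set.mem_ofPred_eq, Set.mem_empty_iff_false, iff_false]
  rintro ⟨h, h1, h2⟩
  by_cases hi : i - 1 < m
  · rw [if_pos (by omega), if_pos hi] at h1
    exact lt_irrefl _ h1
  · rw [if_neg (by omega), if_neg hi] at h2
    exact lt_irrefl _ h2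

lemma exists_twoBlock_of_ncard_tieSet {n : ℕ} (hn : 2 ≤ n) {α : Type*} {f : Fin n → α}
    (hf : (tieSet f).ncard = n - 2) :
    ∃ m a b, 0 < m ∧ m < n ∧ a ≠ b ∧ f = twoBlock m a b := by
  have hsub : tieSet f ⊆ ↑(Finset.Icc 1 (n - 1)) := by
    rintro i ⟨h, -⟩
    simp only [Finset.coe_Icc, Set.mem_Icc]
    omega
  have hcard := Set.ncard_sdiff hsub ((Finset.finite_toSet _).subset hsub)
  rw [Set.ncard_coe_finset, Nat.card_Icc, hf] at hcard
  obtain ⟨m, hm⟩ := Set.ncard_eq_one.1 (hcard.trans (by omega : _ = 1))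
  have hmem : ∀ i, (1 ≤ i ∧ i ≤ n - 1) ∧ i ∉ tieSet f ↔ i = m := fun i => by
    simpa using Set.ext_iff.1 hm i
  obtain ⟨⟨h1, h2⟩, h3⟩ := (hmem m).2 rfl
  have step : ∀ i (hi : i + 1 < n), i + 1 ≠ m → f ⟨i, by omega⟩ = f ⟨i + 1, hi⟩ := by
    intro i hi hne
    by_contra hc
    exact hne ((hmem (i + 1)).1 ⟨by omega, fun ⟨_, e⟩ => hc e⟩)
  have low : ∀ i (hi : i < n), i < m → f ⟨i, hi⟩ = f ⟨0, by omega⟩ := by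
    intro i
    induction i with
    | zero => intros; rfl
    | succ i ih =>
      intro hi him
      rw [← step i hi him.ne]
      exact ih _ (by omega)
  have high : ∀ i (hi : i < n), m ≤ i → f ⟨i, hi⟩ = f ⟨m, by omega⟩ := by
    intro i hi him
    induction i, him using Nat.le_induction with
    | base => rfl
    | succ i him ih =>
      rw [← step i hi (by omega)]
      exact ih _
  refine ⟨m, f ⟨0, by omega⟩, f ⟨m, by omega⟩, h1, by omega, ?_, ?_⟩
  · intro e
    refine h3 ⟨by omega, ?_⟩
    rw [low (m - 1) (by omega) (by omega), e]
  · funext i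
    unfold twoBlock
    split_ifs with hi
    · exact low i i.2 hi
    · exact high i i.2 (by omega)

lemma IsPF.lt_card_le {n : ℕ} {f : Fin n → Fin n} (hf : IsPF f) (k : Fin n) :
    (k : ℕ) < (Finset.univ.filter fun i => f i ≤ k).card := by
  obtain ⟨σ, -, hσ⟩ := hf
  have hle : ((Finset.Iic k).map σ.toEmbedding).card ≤
      (Finset.univ.filter fun i => f i ≤ k).card := by
    refine Finset.card_le_card fun i hi => ?_
    obtain ⟨j, hj, rfl⟩ := Finset.mem_map.1 hi
    exact Finset.mem_filter.2
      ⟨Finset.mem_univ _, Fin.le_def.2 ((hσ j).trans (Fin.le_def.1 (Finset.mem_Iic.1 hj)))⟩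
  rw [Finset.card_map, Fin.card_Iic] at hle
  omega

lemma isPF_twoBlock_iff {n m : ℕ} (h0 : 0 < m) (hm : m < n) {a b : Fin n} (hab : a ≠ b) :
    IsPF (twoBlock m a b) ↔
      ((a : ℕ) = 0 ∧ (b : ℕ) ≤ m) ∨ ((b : ℕ) = 0 ∧ (a : ℕ) ≤ n - m) := by
  have hab' : (a : ℕ) ≠ b := fun h => hab (Fin.ext h)
  constructor
  · intro hf
    have hzero : (a : ℕ) = 0 ∨ (b : ℕ) = 0 := by
      obtain ⟨i, hi⟩ := Finset.card_pos.1 (hf.lt_card_le ⟨0, by omega⟩)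
      simp only [Finset.mem_filter, Fin.le_def, twoBlock] at hi
      split_ifs at hi <;> omega
    rcases hzero with ha | hb
    · refine Or.inl ⟨ha, ?_⟩
      by_contra! hlt
      have hk := hf.lt_card_le ⟨m, hm⟩
      have hle : (Finset.univ.filter fun i : Fin n => twoBlock m a b i ≤ ⟨m, hm⟩).card ≤
          (Finset.Iio (⟨m, hm⟩ : Fin n)).card := by
        refine Finset.card_le_card fun i hi => ?_
        simp only [Finset.mem_filter, Fin.le_def, twoBlock] at hi
        simp only [Finset.mem_Iio, Fin.lt_def]
        split_ifs at hi <;> omega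
      rw [Fin.card_Iio] at hle
      omega
    · refine Or.inr ⟨hb, ?_⟩
      by_contra! hlt
      have hk := hf.lt_card_le ⟨n - m, by omega⟩
      have hle : (Finset.univ.filter fun i : Fin n => twoBlock m a b i ≤ ⟨n - m, by omega⟩).card ≤
          (Finset.Ici (⟨m, hm⟩ : Fin n)).card := by
        refine Finset.card_le_card fun i hi => ?_
        simp only [Finset.mem_filter, Fin.le_def, twoBlock] at hi
        simp only [Finset.mem_Ici, Fin.le_def]
        split_ifs at hi <;> omega
      rw [Fin.card_Ici] at hle
      simp only at hk hle
      omega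
  · rintro (⟨ha, hb⟩ | ⟨hb, ha⟩)
    · refine ⟨Equiv.refl _, fun i j hij => ?_, fun i => ?_⟩
      · change (twoBlock m a b i).val ≤ (twoBlock m a b j).val
        rw [Fin.le_def] at hij
        unfold twoBlock
        split_ifs <;> omega
      · change (twoBlock m a b i).val ≤ i
        unfold twoBlock
        split_ifs <;> omega
    · refine ⟨Fin.revPerm, fun i j hij => ?_, fun i => ?_⟩
      · simp only [Function.comp, Fin.revPerm_apply, Fin.val_rev, Fin.le_def, twoBlock] at hij ⊢
        split_ifs <;> omega
      · simp only [Fin.revPerm_apply, Fin.val_rev, twoBlock]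
        split_ifs <;> omega

lemma twoBlock_inj {n m m' : ℕ} {α : Type*} {a b a' b' : α} (h0 : 0 < m) (hm : m < n)
    (h0' : 0 < m') (hm' : m' < n) (hab : a ≠ b) (hab' : a' ≠ b')
    (h : (twoBlock m a b : Fin n → α) = twoBlock m' a' b') : m = m' ∧ a = a' ∧ b = b' := by
  have hmm : m = m' := by
    have ht := congrArg tieSet h
    rw [tieSet_twoBlock hab, tieSet_twoBlock hab', Finset.coe_inj] at ht
    by_contra hne
    have hmem : m ∈ (Finset.Icc 1 (n - 1)).erase m' := by
      simp only [Finset.mem_erase, Finset.mem_Icc]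
      omega
    exact Finset.notMem_erase m _ (ht ▸ hmem)
  subst hmm
  refine ⟨rfl, ?_, ?_⟩
  · simpa [twoBlock, h0] using congrFun h ⟨0, by omega⟩
  · simpa [twoBlock] using congrFun h ⟨m, hm⟩

/-- The two-block parking function attached to an ordered pair of distinct elements of `Fin n`:
the larger element is the number of zeros, the smaller one is one less than the nonzero value,
and the order of the pair tells which block comes first. -/
def pairTwoBlock {n : ℕ} (p : Fin n × Fin n) : Fin n → Fin n :=
  if h : p.1 < p.2 then
    twoBlock p.2 ⟨0, p.1.pos⟩ ⟨p.1 + 1, (Nat.succ_le_of_lt h).trans_lt p.2.2⟩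
  else if h : p.2 < p.1 then
    twoBlock (n - p.1) ⟨p.2 + 1, (Nat.succ_le_of_lt h).trans_lt p.1.2⟩ ⟨0, p.1.pos⟩
  else fun _ => p.1

/-- For every `n ≥ 2`, the number of parking functions of length `n` with no peaks and
exactly `n-2` ties is `n(n-1)`. -/
theorem stmt11 (n : ℕ) (hn : 2 ≤ n) :
    (Finset.univ.filter (fun f : Fin n → Fin n =>
        IsPF f ∧ peakSet f = ∅ ∧ (tieSet f).ncard = n - 2)).card = n * (n - 1) := by
  have hcard : (Finset.univ : Finset (Fin n)).offDiag.card = n * (n - 1) := by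
    rw [Finset.offDiag_card, Finset.card_univ, Fintype.card_fin, Nat.mul_sub_one]
  rw [← hcard]
  symm
  refine Finset.card_nbij pairTwoBlock ?_ ?_ ?_
  · rintro ⟨x, y⟩ hp
    have hxy : x ≠ y := (Finset.mem_offDiag.1 hp).2.2
    refine Finset.mem_filter.2 ⟨Finset.mem_univ _, ?_⟩
    rcases hxy.lt_or_gt with h | h
    · have hab : (⟨0, x.pos⟩ : Fin n) ≠ ⟨x + 1, (Nat.succ_le_of_lt h).trans_lt y.2⟩ := by
        simp [Fin.ext_iff]
      have h0 : 0 < (y : ℕ) := by omega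
      simp only [pairTwoBlock, h, dif_pos]
      exact ⟨(isPF_twoBlock_iff h0 y.2 hab).2 (Or.inl ⟨rfl, by simpa using h⟩),
        peakSet_twoBlock _ _, ncard_tieSet_twoBlock hab h0 y.2⟩
    · have hab : (⟨y + 1, (Nat.succ_le_of_lt h).trans_lt x.2⟩ : Fin n) ≠ ⟨0, x.pos⟩ := by
        simp [Fin.ext_iff]
      have h0 : 0 < n - (x : ℕ) := by omega
      have h1 : n - (x : ℕ) < n := by omega
      simp only [pairTwoBlock, h, h.not_gt, dif_pos, dif_neg, not_false_eq_true]
      exact ⟨(isPF_twoBlock_iff h0 h1 hab).2 (Or.inr ⟨rfl, by simp only; omega⟩),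
        peakSet_twoBlock _ _, ncard_tieSet_twoBlock hab h0 h1⟩
  · rintro ⟨x, y⟩ hp ⟨x', y'⟩ hp' he
    have hxy : x ≠ y := (Finset.mem_offDiag.1 hp).2.2
    have hxy' : x' ≠ y' := (Finset.mem_offDiag.1 hp').2.2
    rcases hxy.lt_or_gt with h | h <;> rcases hxy'.lt_or_gt with h' | h' <;>
    · simp only [pairTwoBlock, h, h', h.not_gt, h'.not_gt, dif_pos, dif_neg,
        not_false_eq_true] at he
      have := twoBlock_inj (by omega) (by omega) (by omega) (by omega)
        (by simp [Fin.ext_iff]) (by simp [Fin.ext_iff]) he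
      simp only [Fin.ext_iff, Prod.mk.injEq] at this ⊢
      omega
  · intro f hf
    obtain ⟨hpf, -, ht⟩ := (Finset.mem_filter.1 hf).2
    obtain ⟨m, a, b, h0, hm, hab, rfl⟩ := exists_twoBlock_of_ncard_tieSet hn ht
    have hab' : (a : ℕ) ≠ b := fun h => hab (Fin.ext h)
    rcases (isPF_twoBlock_iff h0 hm hab).1 hpf with ⟨ha, hb⟩ | ⟨hb, ha⟩
    · have h : (⟨b - 1, by omega⟩ : Fin n) < ⟨m, hm⟩ := Fin.lt_def.2 (by simp only; omega)
      refine ⟨(⟨b - 1, by omega⟩, ⟨m, hm⟩),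
        Finset.mem_offDiag.2 ⟨Finset.mem_univ _, Finset.mem_univ _, h.ne⟩, ?_⟩
      simp only [pairTwoBlock, h, dif_pos]
      congr 1 <;> apply Fin.ext <;> simp only <;> omega
    · have h : (⟨a - 1, by omega⟩ : Fin n) < ⟨n - m, by omega⟩ :=
        Fin.lt_def.2 (by simp only; omega)
      refine ⟨(⟨n - m, by omega⟩, ⟨a - 1, by omega⟩),
        Finset.mem_offDiag.2 ⟨Finset.mem_univ _, Finset.mem_univ _, h.ne'⟩, ?_⟩
      simp only [pairTwoBlock, h, h.not_gt, dif_pos, dif_neg, not_false_eq_true]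
      congr 1
      · omega
      · apply Fin.ext
        simp only
        omega
      · exact Fin.ext hb.symm
end
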